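/- For all natural numbers n, the partition function satisfies p(5n + 4) ≡ 0 (mod 5). -/

import Mathlib

namespace RamFive

section Alg
variable {A : Type*} [CommRing A]

/-- The finite product `(1 - q) (1 - q^2) ⋯ (1 - q^n)`. -/
def Q (q : A) : ℕ → A
  | 0 => 1
  | n + 1 => Q q n * (1 - q ^ (n + 1))

/-- `(-1)^k q^(k(k+1)/2)`. -/
def t (q : A) : ℕ → A
  | 0 => 1
  | k + 1 => - q ^ (k + 1) * t q k

/-- Coefficients of the finite Jacobi triple product
`(1 - 1/z) ∏_{i=1}^n (1 - z q^i) (1 - q^i / z)` at `z^k`, `k ≥ 0`. -/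
def b (q : A) : ℕ → ℕ → A
  | 0, 0 => 1
  | 0, _ + 1 => 0
  | n + 1, 0 => (1 + q ^ (2 * n + 2) + q ^ (n + 1)) * b q n 0 - q ^ (n + 1) * b q n 1
  | n + 1, k + 1 => (1 + q ^ (2 * n + 2)) * b q n (k + 1)
      - q ^ (n + 1) * (b q n k + b q n (k + 2))

theorem b_eq_zero (q : A) (n : ℕ) : ∀ k, n < k → b q n k = 0 := by
  induction n with
  | zero => intro k hk; obtain ⟨k, rfl⟩ := Nat.exists_eq_add_of_lt hk; simp [b]
  | succ n ih =>
    intro k hk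
    obtain ⟨k, rfl⟩ := Nat.exists_eq_succ_of_ne_zero (by omega : k ≠ 0)
    simp only [b]
    rw [ih (k + 1) (by omega), ih k (by omega), ih (k + 2) (by omega)]
    ring

theorem b_succ_zero (q : A) (n : ℕ) : b q (n + 1) 0 =
    (1 + q ^ (2 * n + 2) + q ^ (n + 1)) * b q n 0 - q ^ (n + 1) * b q n 1 := rfl

theorem b_succ_succ (q : A) (n k : ℕ) : b q (n + 1) (k + 1) =
    (1 + q ^ (2 * n + 2)) * b q n (k + 1) - q ^ (n + 1) * (b q n k + b q n (k + 2)) := rfl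

theorem b_closed (q : A) (n : ℕ) : ∀ k m, k + m = n →
    b q n k * Q q m * Q q (2 * k + m + 1) = t q k * Q q (2 * n + 1) := by
  induction n with
  | zero =>
    intro k m h
    obtain ⟨rfl, rfl⟩ : k = 0 ∧ m = 0 := by omega
    simp [b, t, Q]
  | succ n ih =>
    intro k m h
    have hR : Q q (2 * (n + 1) + 1)
        = Q q (2 * n + 1) * (1 - q ^ (2 * n + 2)) * (1 - q ^ (2 * n + 3)) := rfl
    rw [hR]
    clear hR
    rcases k with _ | k
    · obtain rfl : m = n + 1 := by omega
      rcases n with _ | n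
      · simp [b, t, Q]; ring
      · have h0 := ih 0 (n + 1) (by omega)
        have h1 := ih 1 n (by omega)
        rw [b_succ_zero]
        rw [show 2 * 0 + (n + 1) + 1 = n + 2 by ring] at h0
        rw [show 2 * 1 + n + 1 = n + 3 by ring] at h1
        rw [show 2 * 0 + (n + 1 + 1) + 1 = n + 3 by ring]
        generalize Q q (2 * (n + 1) + 1) = E at *
        clear ih
        simp only [Q, t] at *
        linear_combination (1 + q ^ (2 * (n + 1) + 2) + q ^ (n + 1 + 1)) * (1 - q ^ (n + 2)) * (1 - q ^ (n + 3)) * h0 - q ^ (n + 2) * (1 - q ^ (n + 1)) * (1 - q ^ (n + 2)) * h1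
    · rcases m with _ | _ | m
      · obtain rfl : n = k := by omega
        have h0 := ih n 0 (by omega)
        rw [b_succ_succ]
        rw [b_eq_zero q n (n + 1) (by omega), b_eq_zero q n (n + 2) (by omega)]
        rw [show 2 * n + 0 + 1 = 2 * n + 1 by ring] at h0
        rw [show 2 * (n + 1) + 0 + 1 = 2 * n + 3 by ring]
        clear ih
        simp only [Q, t] at *
        linear_combination (-q ^ (n + 1)) * (1 - q ^ (2 * n + 2)) * (1 - q ^ (2 * n + 3)) * h0
      · obtain rfl : n = k + 1 := by omega
        have h0 := ih (k + 1) 0 (by omega)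
        have h1 := ih k 1 (by omega)
        rw [b_succ_succ]
        rw [b_eq_zero q (k + 1) (k + 2) (by omega)]
        rw [show 2 * (k + 1) + 0 + 1 = 2 * k + 3 by ring] at h0
        rw [show 2 * k + 1 + 1 = 2 * k + 2 by ring] at h1
        rw [show 2 * (k + 1) + (0 + 1) + 1 = 2 * k + 4 by ring]
        rw [show 2 * (k + 1) + 1 = 2 * k + 3 by ring] at *
        clear ih
        simp only [Q, t] at *
        linear_combination (1 + q ^ (2 * (k + 1) + 2)) * (1 - q) * (1 - q ^ (2 * k + 4)) * h0 - q ^ (k + 2) * (1 - q ^ (2 * k + 3)) * (1 - q ^ (2 * k + 4)) * h1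
      · obtain rfl : n = k + m + 2 := by omega
        have h0 := ih (k + 1) (m + 1) (by omega)
        have h1 := ih k (m + 2) (by omega)
        have h2 := ih (k + 2) m (by omega)
        rw [b_succ_succ]
        rw [show 2 * (k + 1) + (m + 1) + 1 = 2 * k + m + 4 by ring] at h0
        rw [show 2 * k + (m + 2) + 1 = 2 * k + m + 3 by ring] at h1
        rw [show 2 * (k + 2) + m + 1 = 2 * k + m + 5 by ring] at h2
        rw [show 2 * (k + 1) + (m + 1 + 1) + 1 = 2 * k + m + 5 by ring]
        generalize Q q (2 * (k + m + 2) + 1) = E at *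
        clear ih
        simp only [Q, t] at *
        linear_combination (1 + q ^ (2 * (k + m + 2) + 2)) * (1 - q ^ (m + 2)) * (1 - q ^ (2 * k + m + 5)) * h0 - q ^ (k + m + 3) * (1 - q ^ (2 * k + m + 4)) * (1 - q ^ (2 * k + m + 5)) * h1 - q ^ (k + m + 3) * (1 - q ^ (m + 1)) * (1 - q ^ (m + 2)) * h2

theorem b_sum_aux (q : A) (n N : ℕ) :
    ∑ k ∈ Finset.range (N + 1), (2 * (k : A) + 1) * b q (n + 1) k
      = (1 - q ^ (n + 1)) ^ 2 * ∑ k ∈ Finset.range (N + 1), (2 * (k : A) + 1) * b q n k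
        - q ^ (n + 1) * ((2 * (N : A) + 1) * b q n (N + 1) - (2 * (N : A) + 3) * b q n N) := by
  induction N with
  | zero => simp [b]; ring
  | succ N ih =>
    rw [Finset.sum_range_succ, ih, Finset.sum_range_succ _ (N + 1)]
    simp only [b]
    push_cast
    ring

theorem b_sum (q : A) (n : ℕ) : ∀ N, n ≤ N →
    ∑ k ∈ Finset.range (N + 1), (2 * (k : A) + 1) * b q n k = Q q n ^ 2 := by
  induction n with
  | zero =>
    intro N _
    rw [Finset.sum_range_succ']
    simp [b, Q]
  | succ n ih =>
    intro N hN
    rw [b_sum_aux, ih N (by omega), b_eq_zero q n (N + 1) (by omega), b_eq_zero q n N (by omega)]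
    simp only [Q]
    ring

end Alg

section PS
open PowerSeries

theorem Q_const {R : Type*} [CommRing R] (n : ℕ) :
    constantCoeff (Q (X : R⟦X⟧) n) = 1 := by
  induction n with
  | zero => simp [Q]
  | succ n ih => simp [Q, ih]

variable {R : Type*} [CommRing R]

theorem Q_isUnit (n : ℕ) : IsUnit (Q (X : R⟦X⟧) n) := by
  rw [PowerSeries.isUnit_iff_constantCoeff, Q_const]
  exact isUnit_one

theorem Q_add (n m : ℕ) : ∃ u : R⟦X⟧, Q X (n + m) = Q X n * (1 + X ^ (n + 1) * u) := by
  induction m with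
  | zero => exact ⟨0, by simp⟩
  | succ m ih =>
    obtain ⟨u, hu⟩ := ih
    refine ⟨u - X ^ m * (1 + X ^ (n + 1) * u), ?_⟩
    rw [← add_assoc, Q, hu]
    ring

theorem t_eq (k : ℕ) : t (X : R⟦X⟧) k = (-1) ^ k * X ^ (k * (k + 1) / 2) := by
  induction k with
  | zero => simp [t]
  | succ k ih =>
    rw [t, ih, show (k + 1) * (k + 1 + 1) / 2 = k * (k + 1) / 2 + (k + 1) by
      rw [show (k + 1) * (k + 1 + 1) = k * (k + 1) + (k + 1) * 2 by ring]
      omega]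
    ring

theorem tri_ge (k : ℕ) : k ≤ k * (k + 1) / 2 := by
  rw [Nat.le_div_iff_mul_le (by norm_num)]
  rcases k with _ | k
  · simp
  · nlinarith

theorem X_pow_dvd_t (k : ℕ) : (X : R⟦X⟧) ^ k ∣ t X k := by
  rw [t_eq]
  exact Dvd.dvd.mul_left (pow_dvd_pow _ (tri_ge k)) _

theorem b_approx (n k : ℕ) (hk : k ≤ n) :
    (X : R⟦X⟧) ^ (n + 1) ∣ b X n k * Q X n - t X k := by
  obtain ⟨m, rfl⟩ := Nat.exists_eq_add_of_le hk
  have h := b_closed (X : R⟦X⟧) (k + m) k m rfl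
  obtain ⟨u, hu⟩ := Q_add (R := R) (2 * k + m + 1) m
  obtain ⟨v, hv⟩ := Q_add (R := R) m k
  rw [show 2 * (k + m) + 1 = 2 * k + m + 1 + m by ring, hu] at h
  have h' : b (X : R⟦X⟧) (k + m) k * Q X m = t X k * (1 + X ^ (2 * k + m + 1 + 1) * u) := by
    apply (Q_isUnit (R := R) (2 * k + m + 1)).mul_right_cancel
    rw [h]; ring
  obtain ⟨w, hw⟩ := X_pow_dvd_t (R := R) k
  rw [add_comm k m, hv, add_comm m k, ← mul_assoc, h', hw]
  refine ⟨w * (X ^ (2 * k + 1) * u + v + X ^ (2 * k + m + 1 + 1) * u * v), ?_⟩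
  ring

/-- Jacobi's identity for the cube of Euler's product, in truncated form. -/
theorem jacobi_cube (n : ℕ) : (X : R⟦X⟧) ^ (n + 1) ∣
    Q X n ^ 3 - ∑ k ∈ Finset.range (n + 1), (2 * (k : R⟦X⟧) + 1) * t X k := by
  have h := b_sum (X : R⟦X⟧) n n le_rfl
  rw [pow_succ (Q (X : R⟦X⟧) n) 2, ← h, Finset.sum_mul, ← Finset.sum_sub_distrib]
  refine Finset.dvd_sum fun k hk => ?_
  rw [mul_assoc, ← mul_sub]
  exact Dvd.dvd.mul_left (b_approx n k (by simpa [Nat.lt_succ_iff] using hk)) _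

theorem Q_eq_prod (n : ℕ) : Q (X : R⟦X⟧) n = ∏ i ∈ Finset.range n, (1 - X ^ (i + 1)) := by
  induction n with
  | zero => simp [Q]
  | succ n ih => rw [Q, ih, Finset.prod_range_succ]

theorem prod_approx (n : ℕ) (s : Finset ℕ) (hs : ∀ i ∈ s, n ≤ i) :
    (X : R⟦X⟧) ^ (n + 1) ∣ (∏ i ∈ s, (1 - X ^ (i + 1)) : R⟦X⟧) - 1 := by
  induction s using Finset.induction_on with
  | empty => simp
  | insert a s ha ih =>
    rw [Finset.prod_insert ha]
    have h1 := ih fun i hi => hs i (Finset.mem_insert_of_mem hi)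
    have h2 : (X : R⟦X⟧) ^ (n + 1) ∣ X ^ (a + 1) :=
      pow_dvd_pow _ (by have := hs a (Finset.mem_insert_self _ _); omega)
    rw [show ∀ p : R⟦X⟧, (1 - X ^ (a + 1)) * p - 1 = (p - 1) - X ^ (a + 1) * p by intro p; ring]
    exact dvd_sub h1 (h2.mul_right _)

theorem pent_approx (n : ℕ) : (X : R⟦X⟧) ^ (n + 1) ∣ pentagonalSeries R - Q X n := by
  rw [X_pow_dvd_iff]
  intro m hm
  obtain ⟨s, hs, hs'⟩ := ((coeff_prod_one_sub_X_pow_eventually_eq R m).and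
    (Filter.eventually_ge_atTop (Finset.range n))).exists
  rw [map_sub, ← hs, ← map_sub]
  refine X_pow_dvd_iff.mp ?_ m hm
  rw [← Finset.prod_sdiff hs', Q_eq_prod,
    show ∀ p r : R⟦X⟧, p * r - r = (p - 1) * r by intro p r; ring]
  refine Dvd.dvd.mul_right (prod_approx n _ fun i hi => ?_) _
  simpa using (Finset.mem_sdiff.mp hi).2

theorem pent_cube (n : ℕ) : (X : R⟦X⟧) ^ (n + 1) ∣ pentagonalSeries R ^ 3 -
    ∑ k ∈ Finset.range (n + 1), (2 * (k : R⟦X⟧) + 1) * t X k := by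
  have h := dvd_add ((pent_approx (R := R) n).trans (sub_dvd_pow_sub_pow _ _ 3)) (jacobi_cube n)
  simpa using h

theorem coeff_pent_cube (n : ℕ) : coeff n (pentagonalSeries R ^ 3) ≠ 0 →
    ∃ k : ℕ, n = k * (k + 1) / 2 ∧ (2 * (k : R) + 1) ≠ 0 := by
  intro h
  have h1 := X_pow_dvd_iff.mp (pent_cube (R := R) n) n (Nat.lt_succ_self n)
  rw [map_sub, sub_eq_zero] at h1
  rw [h1, map_sum] at h
  obtain ⟨k, -, hk⟩ := Finset.exists_ne_zero_of_sum_ne_zero h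
  have e : (2 * (k : R⟦X⟧) + 1) * t X k
      = C ((2 * (k : R) + 1) * (-1) ^ k) * X ^ (k * (k + 1) / 2) := by
    rw [t_eq]; simp [show (C (2 : R) : R⟦X⟧) = 2 from map_ofNat _ 2]; ring
  rw [e, coeff_C_mul, coeff_X_pow] at hk
  refine ⟨k, ?_, ?_⟩
  · by_contra hne
    simp [hne] at hk
  · intro h0
    simp [h0] at hk

theorem coeff_pent_four (n : ℕ) : coeff (5 * n + 4) (pentagonalSeries (ZMod 5) ^ 4) = 0 := by
  rw [pow_succ, coeff_mul]
  refine Finset.sum_eq_zero fun ⟨x, y⟩ hxy => ?_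
  rw [Finset.HasAntidiagonal.mem_antidiagonal] at hxy
  by_contra hne
  have hx := coeff_pent_cube x (left_ne_zero_of_mul hne)
  have hy : y ∈ Set.range pentagonal := by
    by_contra hy
    exact right_ne_zero_of_mul hne (coeff_pentagonalSeries_eq_zero _ hy)
  obtain ⟨k, hk, hk0⟩ := hx
  obtain ⟨j, rfl⟩ := hy
  simp only at hxy
  have hj := two_mul_natCast_pentagonal j
  have hk2 : 2 * x = k * (k + 1) := by
    rw [hk]; exact Nat.mul_div_cancel' (Nat.even_mul_succ_self k).two_dvd
  have e1 : (x : ZMod 5) + (pentagonal j : ZMod 5) = 4 := by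
    have := congrArg (Nat.cast : ℕ → ZMod 5) hxy
    push_cast at this
    rw [this, show (5 : ZMod 5) = 0 from rfl]; ring
  have e2 : 2 * (x : ZMod 5) = k * (k + 1) := by exact_mod_cast congrArg (Nat.cast : ℕ → ZMod 5) hk2
  have e3 : 2 * (pentagonal j : ZMod 5) = j * (3 * j - 1) := by
    exact_mod_cast congrArg (Int.cast : ℤ → ZMod 5) hj
  generalize (x : ZMod 5) = a at *
  generalize (pentagonal j : ZMod 5) = c at *
  generalize (j : ZMod 5) = d at *
  generalize (k : ZMod 5) = e at *
  obtain rfl : c = 4 - a := by rw [← e1]; ring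
  clear hne hj hk2 hxy hk e1
  revert a d e
  decide

theorem coeff_pent_five (n : ℕ) (h : ¬ 5 ∣ n) :
    coeff n (pentagonalSeries (ZMod 5) ^ 5) = 0 := by
  have : Fact (Nat.Prime 5) := ⟨by norm_num⟩
  have := MvPowerSeries.map_frobenius_expand (R := ZMod 5) 5 (by norm_num)
    (f := (pentagonalSeries (ZMod 5) : MvPowerSeries Unit (ZMod 5)))
  have h2 : pentagonalSeries (ZMod 5) ^ 5
      = (PowerSeries.expand 5 (by norm_num) (pentagonalSeries (ZMod 5))).map (frobenius (ZMod 5) 5) :=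
    this.symm
  rw [h2, coeff_map, coeff_expand_of_not_dvd _ _ _ h, map_zero]

theorem part_mul_pent : (PowerSeries.mk fun n => (Fintype.card (Nat.Partition n) : ZMod 5)) *
    pentagonalSeries (ZMod 5) = 1 := by
  have : Fact (Nat.Prime 5) := ⟨by norm_num⟩
  let _ : TopologicalSpace (ZMod 5) := ⊥
  have _ : DiscreteTopology (ZMod 5) := ⟨rfl⟩
  open scoped PowerSeries.WithPiTopology in
  have h1 := Nat.Partition.hasProd_powerSeriesMk_card_restricted (ZMod 5) (fun _ => True)
  open scoped PowerSeries.WithPiTopology in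
  have h2 := h1.mul (PowerSeries.WithPiTopology.hasProd_one_sub_X_pow (ZMod 5))
  open scoped PowerSeries.WithPiTopology in
  have h3 := h2.unique (f := fun i : ℕ => _) (a₂ := (1 : (ZMod 5)⟦X⟧)) (by
    convert! hasProd_one using 1
    ext1 i
    simp only [if_true, pow_mul]
    exact PowerSeries.WithPiTopology.tsum_pow_mul_one_sub_of_constantCoeff_eq_zero (by simp))
  rw [← h3]
  congr 2
  ext n
  simp [Nat.Partition.restricted]

theorem coeff_part (n : ℕ) : (Fintype.card (Nat.Partition (5 * n + 4)) : ZMod 5) = 0 := by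
  set P := PowerSeries.mk fun n => (Fintype.card (Nat.Partition n) : ZMod 5) with hP
  have hc : ∀ m, coeff m P = (Fintype.card (Nat.Partition m) : ZMod 5) := fun m => coeff_mk _ _
  have hmul : P * pentagonalSeries (ZMod 5) ^ 5 = pentagonalSeries (ZMod 5) ^ 4 := by
    rw [pow_succ', ← mul_assoc, part_mul_pent, one_mul]
  have h0 : coeff 0 (pentagonalSeries (ZMod 5) ^ 5) = 1 := by
    have : constantCoeff (pentagonalSeries (ZMod 5)) = 1 := by
      have h := X_pow_dvd_iff.mp (pent_approx (R := ZMod 5) 0) 0 (by norm_num)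
      rw [map_sub, sub_eq_zero] at h
      simpa [Q] using h
    simp [this]
  rw [← hc]
  induction n using Nat.strong_induction_on with
  | _ n ih =>
    have h := coeff_pent_four n
    rw [← hmul, coeff_mul, Finset.sum_eq_single (5 * n + 4, 0), h0, mul_one] at h
    · exact h
    · rintro ⟨x, y⟩ hxy hne
      rw [Finset.HasAntidiagonal.mem_antidiagonal] at hxy
      simp only at hxy ⊢
      by_cases hy : 5 ∣ y
      · obtain ⟨z, rfl⟩ := hy
        have hz : z ≠ 0 := by
          rintro rfl
          exact hne (by simp; omega)
        obtain rfl : x = 5 * (n - z) + 4 := by omega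
        rw [ih (n - z) (by omega), zero_mul]
      · rw [coeff_pent_five y hy, mul_zero]
    · intro h
      simp at h

end PS
end RamFive

theorem ramanujan_congruence_mod_five (n : ℕ) :
    5 ∣ Fintype.card (Nat.Partition (5 * n + 4)) := by
  exact (ZMod.natCast_eq_zero_iff _ _).mp (RamFive.coeff_part n)
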